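/- Let q ∈ [1,∞], p ∈ [1,3), and s < p* := 3p/(3−p). Let (a_ε) be bounded in L^q([0,T]; W^{1,p}(𝕋³)) and (b_ε) be bounded in L^{q'}([0,T]; L^{s'}(𝕋³)), where q', s' are conjugate exponents. Let (φ_η) be a sequence of even mollifiers on 𝕋³. Then the commutator S_{ε,η} := a_ε (b_ε ⋆ φ_η) − (a_ε b_ε) ⋆ φ_η (convolution in x only) converges to 0 in L¹([0,T] × 𝕋³) as η → 0, uniformly in ε. -/

import Mathlib

open MeasureTheory Filter
open scoped ENNReal NNReal

abbrev T3 := Fin 3 → AddCircle (1:ℝ)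

/-- Canonical projection `ℝ³ → 𝕋³`. -/
noncomputable def proj3 (x : Fin 3 → ℝ) : T3 := fun i => (x i : AddCircle (1:ℝ))

/-- Lift of a function on the torus to a (periodic) function on `ℝ³`. -/
noncomputable def liftT3 (g : T3 → ℝ) : (Fin 3 → ℝ) → ℝ := fun x => g (proj3 x)

/-- Fundamental domain of the torus `𝕋³` in `ℝ³`. -/
def D3 : Set (Fin 3 → ℝ) := Set.univ.pi fun _ => Set.Ico (0:ℝ) 1

/-- Mixed norm `L^q_t(L^s_x)` on `[0,T] × α`. -/
noncomputable def mixedNorm {α : Type*} [MeasurableSpace α] (μ : Measure α)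
    (T : ℝ) (q s : ℝ≥0∞) (u : ℝ → α → ℝ) : ℝ≥0∞ :=
  if q = ⊤ then essSup (fun t => eLpNorm (u t) s μ) (volume.restrict (Set.Ioc 0 T))
  else (∫⁻ t in Set.Ioc (0:ℝ) T, (eLpNorm (u t) s μ) ^ q.toReal) ^ (1 / q.toReal)

/-- Partial derivative in direction `i` of a function on `ℝ³`. -/
noncomputable def pd (g : (Fin 3 → ℝ) → ℝ) (i : Fin 3) (x : Fin 3 → ℝ) : ℝ :=
  fderiv ℝ g x (Pi.single i 1)

/-- `C^m` norm of a (smooth, periodic) function on the torus, computed via its lift. -/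
noncomputable def CmNorm (m : ℕ) (g : T3 → ℝ) : ℝ :=
  ∑ j ∈ Finset.range (m + 1), ⨆ x : Fin 3 → ℝ, ‖iteratedFDeriv ℝ j (liftT3 g) x‖

theorem rpow_lintegral_le_lintegral_rpow {Y : Type*} [MeasurableSpace Y] (ν : Measure Y)
    [IsProbabilityMeasure ν] {p : ℝ} (hp : 1 ≤ p) {g : Y → ℝ≥0∞} (hg : Measurable g) :
    (∫⁻ y, g y ∂ν) ^ p ≤ ∫⁻ y, g y ^ p ∂ν := by
  have hp0 : 0 < p := by linarith
  have h := eLpNorm_le_eLpNorm_of_exponent_le (μ := ν) (p := 1) (q := ENNReal.ofReal p) (f := g)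
    (by simpa using ENNReal.ofReal_le_ofReal hp) hg.aestronglyMeasurable
  rw [eLpNorm_one_eq_lintegral_enorm, eLpNorm_eq_lintegral_rpow_enorm_toReal
    (by simpa using hp0) ENNReal.ofReal_ne_top, ENNReal.toReal_ofReal hp0.le] at h
  simp only [enorm_eq_self] at h
  calc _ ≤ _ := ENNReal.rpow_le_rpow h hp0.le
    _ = _ := by rw [← ENNReal.rpow_mul, one_div_mul_cancel hp0.ne', ENNReal.rpow_one]

theorem eLpNorm_ofReal_eq {X F : Type*} [MeasurableSpace X] [NormedAddCommGroup F] (μ : Measure X)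
    {p : ℝ} (hp : 0 < p) (f : X → F) :
    eLpNorm f (ENNReal.ofReal p) μ = (∫⁻ x, ‖f x‖ₑ ^ p ∂μ) ^ (1 / p) := by
  rw [eLpNorm_eq_lintegral_rpow_enorm_toReal (by simpa using hp) ENNReal.ofReal_ne_top,
    ENNReal.toReal_ofReal hp.le]

/-- If `f` is pointwise bounded by an average of functions, its `L^p` norm is at most the supremum
of their `L^p` norms. -/
theorem eLpNorm_le_of_enorm_le_lintegral {X Y F : Type*} [MeasurableSpace X] [MeasurableSpace Y]
    [NormedAddCommGroup F] (μ : Measure X) [SFinite μ] (ν : Measure Y) [IsProbabilityMeasure ν]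
    {p : ℝ} (hp : 1 ≤ p) {f : X → F} {K : X → Y → ℝ≥0∞} (hK : Measurable (Function.uncurry K))
    (hfK : ∀ x, ‖f x‖ₑ ≤ ∫⁻ y, K x y ∂ν) {M : ℝ≥0∞}
    (hM : ∀ y, (∫⁻ x, K x y ^ p ∂μ) ^ (1 / p) ≤ M) :
    eLpNorm f (ENNReal.ofReal p) μ ≤ M := by
  have hp0 : 0 < p := by linarith
  rw [eLpNorm_ofReal_eq μ hp0]
  have hM' : ∀ y, (∫⁻ x, K x y ^ p ∂μ) ≤ M ^ p := fun y ↦ by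
    have := ENNReal.rpow_le_rpow (hM y) hp0.le
    rwa [← ENNReal.rpow_mul, one_div_mul_cancel hp0.ne', ENNReal.rpow_one] at this
  calc (∫⁻ x, ‖f x‖ₑ ^ p ∂μ) ^ (1 / p)
      ≤ (∫⁻ x, ∫⁻ y, K x y ^ p ∂ν ∂μ) ^ (1 / p) := by
        gcongr with x
        exact (ENNReal.rpow_le_rpow (hfK x) hp0.le).trans
          (rpow_lintegral_le_lintegral_rpow ν hp hK.of_uncurry_left)
    _ = (∫⁻ y, ∫⁻ x, K x y ^ p ∂μ ∂ν) ^ (1 / p) := by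
        rw [lintegral_lintegral_swap]
        exact (hK.pow_const p).aemeasurable
    _ ≤ (∫⁻ _, M ^ p ∂ν) ^ (1 / p) := by
        gcongr with y
        exact hM' y
    _ = M := by
        rw [lintegral_const, measure_univ, mul_one, ← ENNReal.rpow_mul, mul_one_div_cancel hp0.ne',
          ENNReal.rpow_one]

/-- Interpolation between Lebesgue norms. -/
theorem eLpNorm_le_rpow_mul_rpow {X F : Type*} [MeasurableSpace X] [NormedAddCommGroup F]
    (μ : Measure X) {p s r : ℝ} (hp : 0 < p) (hps : p ≤ s) (hsr : s < r) {f : X → F}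
    (hf : AEStronglyMeasurable f μ) :
    eLpNorm f (ENNReal.ofReal s) μ ≤ eLpNorm f (ENNReal.ofReal p) μ ^ ((r - s) / (r - p) * p / s) *
      eLpNorm f (ENNReal.ofReal r) μ ^ ((s - p) / (r - p) * r / s) := by
  have hs : 0 < s := by linarith
  have hr : 0 < r := by linarith
  have hrp : 0 < r - p := by linarith
  rw [eLpNorm_ofReal_eq μ hp, eLpNorm_ofReal_eq μ hs, eLpNorm_ofReal_eq μ hr]
  have hα : 0 ≤ (r - s) / (r - p) := div_nonneg (by linarith) hrp.le
  have hβ : 0 ≤ (s - p) / (r - p) := div_nonneg (by linarith) hrp.le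
  have key := ENNReal.lintegral_mul_norm_pow_le (μ := μ) (hf.enorm.pow_const p)
    (hf.enorm.pow_const r) hα hβ (by field_simp; ring)
  have hpt : ∀ x, (‖f x‖ₑ ^ p) ^ ((r - s) / (r - p)) * (‖f x‖ₑ ^ r) ^ ((s - p) / (r - p))
      = ‖f x‖ₑ ^ s := fun x ↦ by
    rw [← ENNReal.rpow_mul, ← ENNReal.rpow_mul, ← ENNReal.rpow_add_of_nonneg _ _ (by positivity)
      (by positivity)]
    congr 1
    field_simp
    ring
  simp_rw [hpt] at key
  calc _ ≤ _ := ENNReal.rpow_le_rpow key (by positivity : 0 ≤ 1 / s)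
    _ = _ := by
      rw [ENNReal.mul_rpow_of_nonneg _ _ (by positivity)]
      simp_rw [← ENNReal.rpow_mul]
      congr 2 <;> field_simp

theorem eLpNorm_translate_sub_le {E : Type*} [NormedAddCommGroup E] [NormedSpace ℝ E]
    [MeasurableSpace E] [BorelSpace E] [SecondCountableTopology E] (μ : Measure E) [SFinite μ]
    [μ.IsAddRightInvariant] {p : ℝ} (hp : 1 ≤ p) {f : E → ℝ} (hf : ContDiff ℝ 1 f) (h : E) :
    eLpNorm (fun x ↦ f (x + h) - f x) (ENNReal.ofReal p) μ ≤
      ‖h‖ₑ * eLpNorm (fderiv ℝ f) (ENNReal.ofReal p) μ := by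
  have hp0 : 0 < p := by linarith
  have hcont : Continuous (fderiv ℝ f) := hf.continuous_fderiv one_ne_zero
  have : IsProbabilityMeasure (volume.restrict (Set.Ioc (0:ℝ) 1)) := ⟨by simp⟩
  refine eLpNorm_le_of_enorm_le_lintegral μ (volume.restrict (Set.Ioc (0:ℝ) 1)) hp
    (K := fun x t ↦ ‖h‖ₑ * ‖fderiv ℝ f (x + t • h)‖ₑ) ?_ ?_ ?_
  · have : Continuous (fun z : E × ℝ ↦ fderiv ℝ f (z.1 + z.2 • h)) := by fun_prop
    exact (continuous_enorm.comp this).measurable.const_mul ‖h‖ₑ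
  · intro x
    have hd : ∀ t : ℝ, HasDerivAt (fun t : ℝ ↦ f (x + t • h)) (fderiv ℝ f (x + t • h) h) t := by
      intro t
      have h1 : HasDerivAt (fun t : ℝ ↦ x + t • h) h t := by
        simpa using ((hasDerivAt_id t).smul_const h).const_add x
      exact ((hf.differentiable one_ne_zero) _).hasFDerivAt.comp_hasDerivAt t h1
    have hint : Continuous (fun t : ℝ ↦ fderiv ℝ f (x + t • h) h) := by fun_prop
    have := intervalIntegral.integral_eq_sub_of_hasDerivAt (a := 0) (b := 1)
      (fun t _ ↦ hd t) (hint.intervalIntegrable _ _)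
    simp only [one_smul, zero_smul, add_zero] at this
    rw [← this, intervalIntegral.integral_of_le zero_le_one]
    refine (enorm_integral_le_lintegral_enorm _).trans (lintegral_mono fun t ↦ ?_)
    rw [mul_comm]
    exact ContinuousLinearMap.le_opENorm _ _
  · intro t
    rw [eLpNorm_ofReal_eq μ hp0]
    simp_rw [ENNReal.mul_rpow_of_nonneg _ _ hp0.le]
    rw [lintegral_const_mul' _ _ (by simp [hp0.le]),
      lintegral_add_right_eq_self (μ := μ) (fun x ↦ ‖fderiv ℝ f x‖ₑ ^ p) (t • h),
      ENNReal.mul_rpow_of_nonneg _ _ (by positivity), ← ENNReal.rpow_mul,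
      mul_one_div_cancel hp0.ne', ENNReal.rpow_one]

/-- Modulus of continuity of translations in subcritical `L^s`, obtained by interpolating between
the mean value estimate in `L^p` and the Gagliardo–Nirenberg–Sobolev inequality. -/
theorem exists_eLpNorm_translate_sub_le_fderiv {p s : ℝ} (hp1 : 1 ≤ p) (hp3 : p < 3) (hps : p ≤ s)
    (hs : s < 3 * p / (3 - p)) : ∃ θ > (0 : ℝ), ∃ M : ℝ≥0∞, M ≠ ⊤ ∧
    ∀ f : (Fin 3 → ℝ) → ℝ, ContDiff ℝ 1 f → HasCompactSupport f → ∀ h : Fin 3 → ℝ,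
      eLpNorm (fun x ↦ f (x + h) - f x) (ENNReal.ofReal s) volume ≤
        M * ‖h‖ₑ ^ θ * eLpNorm (fderiv ℝ f) (ENNReal.ofReal p) volume := by
  have hp0 : 0 < p := by linarith
  have hs0 : 0 < s := by linarith
  have h3p : 0 < 3 - p := by linarith
  set r : ℝ := 3 * p / (3 - p) with hr
  have hr0 : 0 < r := by linarith
  have hrp : 0 < r - p := by linarith
  have hrs : 0 < r - s := by linarith
  set S : ℝ≥0 := SNormLESNormFDerivOfEqConst ℝ (volume : Measure (Fin 3 → ℝ)) (p.toNNReal : ℝ)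
  have hα : 0 < (r - s) / (r - p) * p / s := by positivity
  have hβ : 0 ≤ (s - p) / (r - p) * r / s := by
    have : 0 ≤ s - p := by linarith
    positivity
  refine ⟨(r - s) / (r - p) * p / s, hα, (2 * S) ^ ((s - p) / (r - p) * r / s),
    ENNReal.rpow_ne_top_of_nonneg hβ (by finiteness), fun f hf hfs h ↦ ?_⟩
  set D := eLpNorm (fderiv ℝ f) (ENNReal.ofReal p) volume
  have hfc := hf.continuous
  have hm : Measurable f := hfc.measurable
  have h1 : eLpNorm (fun x ↦ f (x + h) - f x) (ENNReal.ofReal p) volume ≤ ‖h‖ₑ * D :=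
    eLpNorm_translate_sub_le volume hp1 hf h
  have h2 : eLpNorm f (ENNReal.ofReal r) volume ≤ S * D := by
    have := eLpNorm_le_eLpNorm_fderiv_of_eq (μ := (volume : Measure (Fin 3 → ℝ))) (F := ℝ)
      (p := p.toNNReal) (p' := r.toNNReal) hf hfs (by simpa using hp1) (by simp)
      (by
        rw [NNReal.coe_inv, Real.coe_toNNReal _ hp0.le, Real.coe_toNNReal _ hr0.le, hr]
        simp
        field_simp)
    exact this
  have h3 : eLpNorm (fun x ↦ f (x + h) - f x) (ENNReal.ofReal r) volume ≤ 2 * S * D := by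
    have hr1 : 1 ≤ ENNReal.ofReal r := by
      simpa using ENNReal.ofReal_le_ofReal (show 1 ≤ r by linarith)
    have ht : eLpNorm (fun x ↦ f (x + h)) (ENNReal.ofReal r) volume
        = eLpNorm f (ENNReal.ofReal r) volume :=
      eLpNorm_comp_measurePreserving hm.aestronglyMeasurable
        (measurePreserving_add_right volume h)
    calc _ ≤ eLpNorm (fun x ↦ f (x + h)) (ENNReal.ofReal r) volume
          + eLpNorm f (ENNReal.ofReal r) volume :=
        eLpNorm_sub_le (by fun_prop) hm.aestronglyMeasurable hr1
      _ ≤ S * D + S * D := by rw [ht]; gcongr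
      _ = _ := by ring
  calc _ ≤ _ := eLpNorm_le_rpow_mul_rpow volume hp0 hps hs (by fun_prop)
    _ ≤ (‖h‖ₑ * D) ^ ((r - s) / (r - p) * p / s) * (2 * S * D) ^ ((s - p) / (r - p) * r / s) := by
      gcongr
    _ = (2 * S) ^ ((s - p) / (r - p) * r / s) * ‖h‖ₑ ^ ((r - s) / (r - p) * p / s) *
        (D ^ ((r - s) / (r - p) * p / s) * D ^ ((s - p) / (r - p) * r / s)) := by
      rw [ENNReal.mul_rpow_of_nonneg _ _ hα.le, ENNReal.mul_rpow_of_nonneg _ _ hβ]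
      ring
    _ = _ := by
      rw [← ENNReal.rpow_add_of_nonneg _ _ hα.le hβ]
      have : (r - s) / (r - p) * p / s + (s - p) / (r - p) * r / s = 1 := by
        field_simp
        ring
      rw [this, ENNReal.rpow_one]

theorem enorm_le_sum_enorm_apply_single {n : ℕ} (L : (Fin n → ℝ) →L[ℝ] ℝ) :
    ‖L‖ₑ ≤ ∑ i, ‖L (Pi.single i 1)‖ₑ := by
  have h : ‖L‖₊ ≤ ∑ i, ‖L (Pi.single i 1)‖₊ := by
    refine ContinuousLinearMap.opNNNorm_le_bound _ _ fun x ↦ ?_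
    have hx : L x = ∑ i, x i * L (Pi.single i 1) := by
      conv_lhs => rw [pi_eq_sum_univ' x]
      simp [map_sum]
    rw [hx, Finset.sum_mul]
    refine (nnnorm_sum_le _ _).trans (Finset.sum_le_sum fun i _ ↦ ?_)
    rw [nnnorm_mul, mul_comm]
    gcongr
    exact nnnorm_le_pi_nnnorm x i
  simp only [enorm_eq_nnnorm]
  exact_mod_cast h

theorem pd_const_sub {ρ : (Fin 3 → ℝ) → ℝ} (hρ : Differentiable ℝ ρ) (i : Fin 3) (x t : Fin 3 → ℝ) :
    pd (fun y ↦ ρ (x - y)) i t = - pd ρ i (x - t) := by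
  have h : HasFDerivAt (fun y ↦ ρ (x - y)) _ t :=
    (hρ (x - t)).hasFDerivAt.comp t ((hasFDerivAt_id t).const_sub x)
  simp [pd, h.fderiv]

/-- Mollification commutes with weak partial derivatives. -/
theorem pd_convolution_eq {U W : (Fin 3 → ℝ) → ℝ} (i : Fin 3) (hU : LocallyIntegrable U)
    (hweak : ∀ ψ : (Fin 3 → ℝ) → ℝ, ContDiff ℝ (⊤ : ℕ∞) ψ → HasCompactSupport ψ →
      ∫ y, U y * pd ψ i y = - ∫ y, W y * ψ y)
    {ρ : (Fin 3 → ℝ) → ℝ} (hρ : ContDiff ℝ (⊤ : ℕ∞) ρ) (hρc : HasCompactSupport ρ)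
    (x : Fin 3 → ℝ) :
    pd (convolution ρ U (ContinuousLinearMap.lsmul ℝ ℝ) volume) i x =
      ∫ y, ρ y * W (x - y) := by
  have hρ1 : ContDiff ℝ 1 ρ := hρ.of_le (by exact_mod_cast le_top)
  have h1 := hρc.hasFDerivAt_convolution_right (ContinuousLinearMap.lsmul ℝ ℝ).flip hU hρ1 x
  rw [convolution_flip] at h1
  rw [pd, h1.fderiv, convolution_precompR_apply _ hU (hρc.fderiv (𝕜 := ℝ))
    (hρ1.continuous_fderiv one_ne_zero)]
  have h2 := hweak (fun y ↦ ρ (x - y)) (hρ.comp (contDiff_const.sub contDiff_id))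
    (hρc.comp_homeomorph (Homeomorph.subLeft x))
  simp only [pd_const_sub (hρ1.differentiable one_ne_zero), mul_neg, integral_neg, neg_inj] at h2
  rw [← integral_sub_left_eq_self _ volume x]
  simp only [sub_sub_cancel]
  simp only [convolution_def, ContinuousLinearMap.flip_apply, ContinuousLinearMap.lsmul_apply,
    smul_eq_mul]
  simp only [mul_comm] at h2 ⊢
  exact h2

/-- Translation estimates for compactly supported `C¹` functions pass to functions with weak
gradients. -/
theorem eLpNorm_translate_sub_le_weak {p s θ : ℝ} {M : ℝ≥0∞} (hp1 : 1 ≤ p)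
    (hM : ∀ f : (Fin 3 → ℝ) → ℝ, ContDiff ℝ 1 f → HasCompactSupport f → ∀ h : Fin 3 → ℝ,
      eLpNorm (fun x ↦ f (x + h) - f x) (ENNReal.ofReal s) volume ≤
        M * ‖h‖ₑ ^ θ * eLpNorm (fderiv ℝ f) (ENNReal.ofReal p) volume)
    {U : (Fin 3 → ℝ) → ℝ} {V : Fin 3 → (Fin 3 → ℝ) → ℝ} (hU : LocallyIntegrable U)
    (hUc : HasCompactSupport U) (hV : ∀ i, Measurable (V i))
    (hweak : ∀ (i : Fin 3) (ψ : (Fin 3 → ℝ) → ℝ), ContDiff ℝ (⊤ : ℕ∞) ψ →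
      HasCompactSupport ψ → ∫ y, U y * pd ψ i y = - ∫ y, V i y * ψ y) (h : Fin 3 → ℝ) :
    eLpNorm (fun x ↦ U (x + h) - U x) (ENNReal.ofReal s) volume ≤
      M * ‖h‖ₑ ^ θ * (∫⁻ x, (∑ i, ‖V i x‖ₑ) ^ p) ^ (1 / p) := by
  let φ : ℕ → ContDiffBump (0 : Fin 3 → ℝ) := fun n ↦
    ⟨1 / ((n : ℝ) + 1), 2 * (1 / ((n : ℝ) + 1)), by positivity,
      by have : 0 < 1 / ((n : ℝ) + 1) := by positivity
         linarith⟩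
  let F : ℕ → (Fin 3 → ℝ) → ℝ := fun n ↦
    convolution ((φ n).normed volume) U (ContinuousLinearMap.lsmul ℝ ℝ) volume
  have hlim : ∀ᵐ x, Tendsto (fun n ↦ F n x) atTop (nhds (U x)) :=
    ContDiffBump.ae_convolution_tendsto_right_of_locallyIntegrable (φ := φ) (K := 2)
      (by simpa [φ] using (tendsto_one_div_add_atTop_nhds_zero_nat (𝕜 := ℝ)).const_mul 2)
      (Eventually.of_forall fun n ↦ le_rfl) hU
  have hρ : ∀ n, ContDiff ℝ (⊤ : ℕ∞) ((φ n).normed volume) := fun n ↦ (φ n).contDiff_normed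
  have hρc : ∀ n, HasCompactSupport ((φ n).normed volume) := fun n ↦
    (φ n).hasCompactSupport_normed
  have hFs : ∀ n, ContDiff ℝ 1 (F n) := fun n ↦
    (hρc n).contDiff_convolution_left (n := 1) _ (φ n).contDiff_normed hU
  have hFc : ∀ n, HasCompactSupport (F n) := fun n ↦ (hρc n).convolution _ hUc
  have hgrad : ∀ n, eLpNorm (fderiv ℝ (F n)) (ENNReal.ofReal p) volume ≤
      (∫⁻ x, (∑ i, ‖V i x‖ₑ) ^ p) ^ (1 / p) := by
    intro n
    let ρ := (φ n).normed volume
    have hρm : Measurable fun y ↦ ENNReal.ofReal (ρ y) :=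
      ((hρ n).continuous.measurable).ennreal_ofReal
    have hρi : ∫⁻ y, ENNReal.ofReal (ρ y) = 1 := by
      rw [← ofReal_integral_eq_lintegral_ofReal ((φ n).integrable_normed)
        (Eventually.of_forall fun y ↦ (φ n).nonneg_normed y), (φ n).integral_normed]
      simp
    have : IsProbabilityMeasure (volume.withDensity fun y ↦ ENNReal.ofReal (ρ y)) :=
      ⟨by rw [withDensity_apply _ MeasurableSet.univ, Measure.restrict_univ, hρi]⟩
    have hN : Measurable fun x ↦ ∑ i, ‖V i x‖ₑ :=
      Finset.measurable_fun_sum _ fun i _ ↦ (hV i).enorm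
    refine eLpNorm_le_of_enorm_le_lintegral volume
      (volume.withDensity fun y ↦ ENNReal.ofReal (ρ y)) hp1
      (K := fun x y ↦ ∑ i, ‖V i (x - y)‖ₑ) (hN.comp (measurable_fst.sub measurable_snd)) ?_ ?_
    · intro x
      rw [lintegral_withDensity_eq_lintegral_mul _ hρm
        (by fun_prop : Measurable fun y ↦ ∑ i, ‖V i (x - y)‖ₑ)]
      refine (enorm_le_sum_enorm_apply_single _).trans ?_
      calc ∑ i, ‖fderiv ℝ (F n) x (Pi.single i 1)‖ₑ
          ≤ ∑ i, ∫⁻ y, ENNReal.ofReal (ρ y) * ‖V i (x - y)‖ₑ := by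
            refine Finset.sum_le_sum fun i _ ↦ ?_
            have := pd_convolution_eq i hU (hweak i) (hρ n) (hρc n) x
            simp only [pd] at this
            rw [this]
            refine (enorm_integral_le_lintegral_enorm _).trans (lintegral_mono fun y ↦ ?_)
            rw [enorm_mul, Real.enorm_of_nonneg ((φ n).nonneg_normed y)]
        _ = _ := by
            rw [← lintegral_finsetSum]
            · simp [Finset.mul_sum, ρ]
            · exact fun i _ ↦ hρm.mul ((hV i).comp (measurable_const.sub measurable_id)).enorm
    · intro y
      rw [lintegral_sub_right_eq_self (fun x ↦ (∑ i, ‖V i x‖ₑ) ^ p) y]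
  refine (Lp.eLpNorm_lim_le_liminf_eLpNorm (f := fun n x ↦ F n (x + h) - F n x)
    (fun n ↦ ?_) _ ?_).trans ?_
  · have := (hFs n).continuous
    fun_prop
  · have := (measurePreserving_add_right volume h).quasiMeasurePreserving.ae hlim
    filter_upwards [hlim, this] with x h1 h2 using h2.sub h1
  · refine liminf_le_of_frequently_le' (Frequently.of_forall fun n ↦ ?_)
    exact (hM _ (hFs n) (hFc n) h).trans (by gcongr; exact hgrad n)

instance isProbabilityMeasure_T3 : IsProbabilityMeasure (volume : Measure T3) := by
  have : IsProbabilityMeasure (volume : Measure (AddCircle (1 : ℝ))) :=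
    ⟨by simp [AddCircle.measure_univ]⟩
  rw [volume_pi]
  infer_instance

theorem measurePreserving_proj3 (c : Fin 3 → ℝ) : MeasurePreserving proj3
    (volume.restrict (Set.univ.pi fun i ↦ Set.Ioc (c i) (c i + 1))) volume := by
  rw [volume_pi, Measure.restrict_pi_pi, volume_pi]
  exact measurePreserving_pi _ _ fun i ↦ AddCircle.measurePreserving_mk 1 (c i)

theorem measurable_proj3 : Measurable proj3 :=
  measurable_pi_lambda _ fun i ↦ AddCircle.measurable_mk'.comp (measurable_pi_apply i)

theorem lintegral_box_comp_proj3_le (n : ℕ) {F : T3 → ℝ≥0∞} (hF : Measurable F) :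
    ∫⁻ x in Set.univ.pi fun _ ↦ Set.Ioc (-n : ℝ) n, F (proj3 x) ≤
      (2 * n : ℕ) ^ 3 * ∫⁻ y, F y := by
  have hsub : (Set.univ.pi fun _ ↦ Set.Ioc (-n : ℝ) n) ⊆
      ⋃ k : Fin 3 → Fin (2 * n), Set.univ.pi fun i ↦
        Set.Ioc ((k i : ℝ) - n) ((k i : ℝ) - n + 1) := by
    intro x hx
    simp only [Set.mem_pi, Set.mem_univ, true_implies, Set.mem_Ioc] at hx
    have hk : ∀ i, ∃ k : Fin (2 * n), (k : ℝ) - n < x i ∧ x i ≤ (k : ℝ) - n + 1 := by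
      intro i
      have h1 : -(n : ℤ) < ⌈x i⌉ := by
        rw [Int.lt_ceil]
        push_cast
        exact (hx i).1
      have h2 : ⌈x i⌉ ≤ n := by
        rw [Int.ceil_le]
        exact_mod_cast (hx i).2
      obtain ⟨m, hm⟩ := Int.eq_ofNat_of_zero_le (show 0 ≤ ⌈x i⌉ - 1 + n by omega)
      refine ⟨⟨m, by omega⟩, ?_⟩
      have hm' : (m : ℝ) = ⌈x i⌉ - 1 + n := by exact_mod_cast hm.symm
      have h3 := Int.ceil_lt_add_one (x i)
      have h4 := Int.le_ceil (x i)
      simp only [hm']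
      constructor <;> linarith
    choose k hk using hk
    exact Set.mem_iUnion.2 ⟨k, fun i _ ↦ hk i⟩
  calc _ ≤ _ := lintegral_mono_set hsub
    _ ≤ _ := lintegral_iUnion_le _ _
    _ = ∑' _ : Fin 3 → Fin (2 * n), ∫⁻ y, F y := by
        congr with k
        exact (measurePreserving_proj3 fun i ↦ (k i : ℝ) - n).lintegral_comp hF
    _ = _ := by simp

theorem closedBall_subset_box {n : ℕ} {R : ℝ} (h : R < n) : Metric.closedBall (0 : Fin 3 → ℝ) R ⊆
    Set.univ.pi fun _ ↦ Set.Ioc (-n : ℝ) n := by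
  intro x hx i _
  have h1 : |x i| ≤ R := (norm_le_pi_norm x i).trans (by simpa using hx)
  obtain ⟨h2, h3⟩ := abs_le.1 h1
  constructor <;> linarith

theorem locallyIntegrable_liftT3 {w : T3 → ℝ} (hw : Measurable w) (hi : ∫⁻ y, ‖w y‖ₑ ≠ ⊤) :
    LocallyIntegrable (liftT3 w) := by
  rw [locallyIntegrable_iff]
  intro K hK
  obtain ⟨R, hR⟩ := hK.isBounded.subset_closedBall 0
  obtain ⟨n, hn⟩ := exists_nat_gt R
  refine IntegrableOn.mono_set ⟨(hw.comp measurable_proj3).aestronglyMeasurable, ?_⟩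
    (hR.trans (closedBall_subset_box hn))
  exact (lintegral_box_comp_proj3_le n hw.enorm).trans_lt (by finiteness)

/-- Weak gradients satisfy the Leibniz rule against a smooth cutoff. -/
theorem weak_pd_cutoff {u w χ : (Fin 3 → ℝ) → ℝ} (i : Fin 3) (hu : LocallyIntegrable u)
    (hw : LocallyIntegrable w) (hχ : ContDiff ℝ (⊤ : ℕ∞) χ)
    (hweak : ∀ ψ : (Fin 3 → ℝ) → ℝ, ContDiff ℝ (⊤ : ℕ∞) ψ → HasCompactSupport ψ →
      ∫ y, u y * pd ψ i y = - ∫ y, w y * ψ y)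
    (ψ : (Fin 3 → ℝ) → ℝ) (hψ : ContDiff ℝ (⊤ : ℕ∞) ψ) (hψc : HasCompactSupport ψ) :
    ∫ y, (χ y * u y) * pd ψ i y = - ∫ y, (χ y * w y + pd χ i y * u y) * ψ y := by
  have hpdc : ∀ f : (Fin 3 → ℝ) → ℝ, ContDiff ℝ (⊤ : ℕ∞) f → Continuous (pd f i) := fun f hf ↦
    (hf.continuous_fderiv (by simp)).clm_apply continuous_const
  have hpdψ : HasCompactSupport (pd ψ i) :=
    (hψc.fderiv (𝕜 := ℝ)).comp_left (g := fun L : (Fin 3 → ℝ) →L[ℝ] ℝ ↦ L (Pi.single i 1)) rfl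
  have h := hweak (fun y ↦ χ y * ψ y) (hχ.mul hψ) hψc.mul_left
  have hpd : ∀ y, pd (fun y ↦ χ y * ψ y) i y = χ y * pd ψ i y + ψ y * pd χ i y := by
    intro y
    have h1 := (hχ.differentiable (by simp) y).hasFDerivAt.mul
      (hψ.differentiable (by simp) y).hasFDerivAt
    have h2 : fderiv ℝ (fun y ↦ χ y * ψ y) y = _ := h1.fderiv
    simp [pd, h2]
  have I1 : Integrable fun y ↦ (χ y * pd ψ i y) * u y :=
    hu.integrable_smul_left_of_hasCompactSupport (hχ.continuous.mul (hpdc ψ hψ)) hpdψ.mul_left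
  have I2 : Integrable fun y ↦ (ψ y * pd χ i y) * u y :=
    hu.integrable_smul_left_of_hasCompactSupport (hψ.continuous.mul (hpdc χ hχ)) hψc.mul_right
  have I3 : Integrable fun y ↦ (χ y * ψ y) * w y :=
    hw.integrable_smul_left_of_hasCompactSupport (hχ.continuous.mul hψ.continuous) hψc.mul_left
  have e1 : ∫ y, u y * pd (fun y ↦ χ y * ψ y) i y
      = (∫ y, (χ y * pd ψ i y) * u y) + ∫ y, (ψ y * pd χ i y) * u y := by
    rw [← integral_add I1 I2]
    congr with y
    rw [hpd]
    ring
  have e2 : ∫ y, (χ y * w y + pd χ i y * u y) * ψ y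
      = (∫ y, (χ y * ψ y) * w y) + ∫ y, (ψ y * pd χ i y) * u y := by
    rw [← integral_add I3 I2]
    congr with y
    ring
  have e3 : ∫ y, w y * (χ y * ψ y) = ∫ y, (χ y * ψ y) * w y := by
    congr with y
    ring
  have e4 : ∫ y, (χ y * u y) * pd ψ i y = ∫ y, (χ y * pd ψ i y) * u y := by
    congr with y
    ring
  rw [e1, e3] at h
  rw [e2, e4]
  linarith

/-- Uniform modulus of continuity of translations in `L^s(𝕋³)` for functions in `W^{1,p}(𝕋³)`. -/
theorem exists_eLpNorm_translate_sub_le_torus {p s : ℝ} (hp1 : 1 ≤ p) (hp3 : p < 3) (hps : p ≤ s)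
    (hs : s < 3 * p / (3 - p)) : ∃ θ > (0 : ℝ), ∃ M : ℝ≥0∞, M ≠ ⊤ ∧
    ∀ (u : T3 → ℝ) (g : T3 → Fin 3 → ℝ), Measurable u → (∀ i, Measurable fun x ↦ g x i) →
      eLpNorm u (ENNReal.ofReal p) volume ≠ ⊤ →
      eLpNorm (fun x ↦ ‖g x‖) (ENNReal.ofReal p) volume ≠ ⊤ →
      (∀ (i : Fin 3) (ψ : (Fin 3 → ℝ) → ℝ), ContDiff ℝ (⊤ : ℕ∞) ψ → HasCompactSupport ψ →
        ∫ y, liftT3 u y * pd ψ i y = - ∫ y, liftT3 (fun x => g x i) y * ψ y) →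
      ∀ h : Fin 3 → ℝ, ‖h‖ ≤ 1 →
        eLpNorm (fun x ↦ u (x + proj3 h) - u x) (ENNReal.ofReal s) volume ≤
          M * ‖h‖ₑ ^ θ * (eLpNorm u (ENNReal.ofReal p) volume +
            eLpNorm (fun x ↦ ‖g x‖) (ENNReal.ofReal p) volume) := by
  obtain ⟨θ, hθ, M, hM, H⟩ := exists_eLpNorm_translate_sub_le_fderiv hp1 hp3 hps hs
  have hp0 : 0 < p := by linarith
  let χ : ContDiffBump (0 : Fin 3 → ℝ) := ⟨2, 3, by norm_num, by norm_num⟩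
  have hχ : ContDiff ℝ (⊤ : ℕ∞) χ := χ.contDiff
  have hχc : HasCompactSupport χ := χ.hasCompactSupport
  have hdχ : Continuous (fderiv ℝ χ) := hχ.continuous_fderiv (by simp)
  obtain ⟨B, hB⟩ := (hχc.fderiv (𝕜 := ℝ)).exists_bound_of_continuous hdχ
  have hpdc : ∀ i, Continuous (pd χ i) := fun i ↦ hdχ.clm_apply continuous_const
  have hpdB : ∀ i x, ‖pd χ i x‖ₑ ≤ ENNReal.ofReal B := by
    intro i x
    rw [← ofReal_norm]
    refine ENNReal.ofReal_le_ofReal ((ContinuousLinearMap.le_opNorm _ _).trans ?_)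
    rw [Pi.norm_single, norm_one, mul_one]
    exact hB x
  obtain ⟨A, hA⟩ : ∃ A : ℝ≥0∞, A = 3 * (1 + ENNReal.ofReal B) := ⟨_, rfl⟩
  have hAt : A ≠ ⊤ := hA ▸ by finiteness
  refine ⟨θ, hθ, M * (A * ((2 * 4 : ℕ) ^ 3 : ℝ≥0∞) ^ (1 / p)), by finiteness, ?_⟩
  intro u g hu hg hup hgp hweak h hh
  have hgm : Measurable g := measurable_pi_iff.2 hg
  have hup1 : ∫⁻ y, ‖u y‖ₑ ≠ ⊤ := by
    rw [← eLpNorm_one_eq_lintegral_enorm]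
    exact ne_top_of_le_ne_top hup (eLpNorm_le_eLpNorm_of_exponent_le
      (by simpa using ENNReal.ofReal_le_ofReal hp1) hu.aestronglyMeasurable)
  have hgp1 : ∀ i, ∫⁻ y, ‖g y i‖ₑ ≠ ⊤ := by
    intro i
    rw [← eLpNorm_one_eq_lintegral_enorm]
    refine ne_top_of_le_ne_top hgp ((eLpNorm_le_eLpNorm_of_exponent_le
      (by simpa using ENNReal.ofReal_le_ofReal hp1) (hg i).aestronglyMeasurable).trans
      (eLpNorm_mono fun x ↦ ?_))
    rw [norm_norm]
    exact norm_le_pi_norm (g x) i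
  have hul := locallyIntegrable_liftT3 hu hup1
  have hgl := fun i ↦ locallyIntegrable_liftT3 (hg i) (hgp1 i)
  have hum : Measurable (liftT3 u) := hu.comp measurable_proj3
  have hglm : ∀ i, Measurable (liftT3 fun x ↦ g x i) := fun i ↦ (hg i).comp measurable_proj3
  have hU : LocallyIntegrable fun x ↦ χ x * liftT3 u x :=
    (hul.integrable_smul_left_of_hasCompactSupport hχ.continuous hχc).locallyIntegrable
  have key := eLpNorm_translate_sub_le_weak hp1 H
    (V := fun i x ↦ χ x * liftT3 (fun y ↦ g y i) x + pd χ i x * liftT3 u x) hU hχc.mul_right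
    (fun i ↦ (hχ.continuous.measurable.mul (hglm i)).add ((hpdc i).measurable.mul hum))
    (fun i ↦ weak_pd_cutoff i hul (hgl i) hχ (hweak i)) h
  have hloc : eLpNorm (fun x ↦ u (x + proj3 h) - u x) (ENNReal.ofReal s) volume ≤
      eLpNorm (fun x ↦ χ (x + h) * liftT3 u (x + h) - χ x * liftT3 u x)
        (ENNReal.ofReal s) volume := by
    have hadd : ∀ x, proj3 (x + h) = proj3 x + proj3 h := fun x ↦ by
      ext i
      simp [proj3]
    rw [← eLpNorm_comp_measurePreserving (by fun_prop) (measurePreserving_proj3 0)]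
    refine le_trans (le_of_eq ?_) (eLpNorm_mono_measure _
      (Measure.restrict_le_self (s := Set.univ.pi fun i ↦
        Set.Ioc ((0 : Fin 3 → ℝ) i) ((0 : Fin 3 → ℝ) i + 1))))
    refine eLpNorm_congr_ae ?_
    filter_upwards [ae_restrict_mem (MeasurableSet.univ_pi fun i ↦ measurableSet_Ioc)] with x hx
    have hx1 : ‖x‖ ≤ 1 := by
      rw [pi_norm_le_iff_of_nonneg zero_le_one]
      intro i
      have := hx i trivial
      simp only [Pi.zero_apply, zero_add, Set.mem_Ioc] at this
      rw [Real.norm_eq_abs, abs_le]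
      constructor <;> linarith [this.1, this.2]
    have h1 : χ x = 1 := χ.one_of_mem_closedBall (by
      simp only [mem_closedBall_zero_iff]
      exact hx1.trans one_le_two)
    have h2 : χ (x + h) = 1 := χ.one_of_mem_closedBall (by
      simp only [mem_closedBall_zero_iff]
      exact (norm_add_le _ _).trans (by change _ ≤ (2 : ℝ); linarith))
    simp [h1, h2, liftT3, hadd]
  have hV : ∀ x, ∑ i, ‖χ x * liftT3 (fun y ↦ g y i) x + pd χ i x * liftT3 u x‖ₑ ≤
      (Set.univ.pi fun _ ↦ Set.Ioc (-(4 : ℕ) : ℝ) (4 : ℕ)).indicator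
        (fun x ↦ A * (‖u (proj3 x)‖ₑ + ‖g (proj3 x)‖ₑ)) x := by
    intro x
    by_cases hx : x ∈ tsupport χ
    · have hxb : x ∈ Set.univ.pi fun _ ↦ Set.Ioc (-(4 : ℕ) : ℝ) (4 : ℕ) := by
        rw [χ.tsupport_eq] at hx
        exact closedBall_subset_box (by norm_num [χ]) hx
      rw [Set.indicator_of_mem hxb]
      have hi : ∀ i, ‖χ x * liftT3 (fun y ↦ g y i) x + pd χ i x * liftT3 u x‖ₑ ≤
          (1 + ENNReal.ofReal B) * (‖u (proj3 x)‖ₑ + ‖g (proj3 x)‖ₑ) := by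
        intro i
        have hχ1 : ‖χ x‖ₑ ≤ 1 := by
          rw [Real.enorm_of_nonneg χ.nonneg]
          simpa using ENNReal.ofReal_le_ofReal (χ.le_one (x := x))
        have hgi : ‖g (proj3 x) i‖ₑ ≤ ‖g (proj3 x)‖ₑ := by
          rw [enorm_le_iff_norm_le]
          exact norm_le_pi_norm _ i
        calc _ ≤ ‖χ x‖ₑ * ‖g (proj3 x) i‖ₑ + ‖pd χ i x‖ₑ * ‖u (proj3 x)‖ₑ := by
              rw [← enorm_mul, ← enorm_mul]
              exact enorm_add_le _ _
          _ ≤ 1 * ‖g (proj3 x)‖ₑ + ENNReal.ofReal B * ‖u (proj3 x)‖ₑ := by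
              gcongr
              exact hpdB i x
          _ ≤ (1 * ‖g (proj3 x)‖ₑ + ENNReal.ofReal B * ‖u (proj3 x)‖ₑ) +
              (1 * ‖u (proj3 x)‖ₑ + ENNReal.ofReal B * ‖g (proj3 x)‖ₑ) := le_self_add
          _ = _ := by ring
      calc _ ≤ ∑ _ : Fin 3, (1 + ENNReal.ofReal B) * (‖u (proj3 x)‖ₑ + ‖g (proj3 x)‖ₑ) :=
            Finset.sum_le_sum fun i _ ↦ hi i
        _ = _ := by simp [hA, mul_assoc]
    · have h1 : χ x = 0 := image_eq_zero_of_notMem_tsupport hx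
      have h2 : fderiv ℝ χ x = 0 :=
        image_eq_zero_of_notMem_tsupport fun h ↦ hx (tsupport_fderiv_subset ℝ h)
      simp [h1, h2, pd]
  have hint : (∫⁻ x, (∑ i, ‖χ x * liftT3 (fun y ↦ g y i) x + pd χ i x * liftT3 u x‖ₑ) ^ p)
      ^ (1 / p) ≤ A * ((2 * 4 : ℕ) ^ 3 : ℝ≥0∞) ^ (1 / p) *
        (eLpNorm u (ENNReal.ofReal p) volume +
          eLpNorm (fun x ↦ ‖g x‖) (ENNReal.ofReal p) volume) := by
    have hF : Measurable fun y ↦ (‖u y‖ₑ + ‖g y‖ₑ) ^ p := (hu.enorm.add hgm.enorm).pow_const p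
    calc _ ≤ (∫⁻ x in Set.univ.pi fun _ ↦ Set.Ioc (-(4 : ℕ) : ℝ) (4 : ℕ),
            A ^ p * (‖u (proj3 x)‖ₑ + ‖g (proj3 x)‖ₑ) ^ p) ^ (1 / p) := by
          rw [← lintegral_indicator (MeasurableSet.univ_pi fun i ↦ measurableSet_Ioc)]
          gcongr with x
          refine (ENNReal.rpow_le_rpow (hV x) hp0.le).trans (le_of_eq ?_)
          by_cases hx : x ∈ Set.univ.pi fun _ ↦ Set.Ioc (-(4 : ℕ) : ℝ) (4 : ℕ)
          · rw [Set.indicator_of_mem hx, Set.indicator_of_mem hx,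
              ENNReal.mul_rpow_of_nonneg _ _ hp0.le]
          · rw [Set.indicator_of_notMem hx, Set.indicator_of_notMem hx,
              ENNReal.zero_rpow_of_pos hp0]
      _ ≤ (A ^ p * ((2 * 4 : ℕ) ^ 3 * ∫⁻ y, (‖u y‖ₑ + ‖g y‖ₑ) ^ p)) ^ (1 / p) := by
          rw [lintegral_const_mul (f := fun x ↦ (‖u (proj3 x)‖ₑ + ‖g (proj3 x)‖ₑ) ^ p) _
            (hF.comp measurable_proj3)]
          gcongr
          exact lintegral_box_comp_proj3_le 4 hF
      _ = A * ((2 * 4 : ℕ) ^ 3 : ℝ≥0∞) ^ (1 / p) * (∫⁻ y, (‖u y‖ₑ + ‖g y‖ₑ) ^ p) ^ (1 / p) := by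
          rw [ENNReal.mul_rpow_of_nonneg _ _ (by positivity),
            ENNReal.mul_rpow_of_nonneg _ _ (by positivity), ← ENNReal.rpow_mul,
            mul_one_div_cancel hp0.ne', ENNReal.rpow_one, mul_assoc]
      _ ≤ _ := by
          gcongr
          rw [eLpNorm_ofReal_eq _ hp0, eLpNorm_ofReal_eq _ hp0]
          simp only [enorm_norm]
          exact ENNReal.lintegral_Lp_add_le hu.enorm.aemeasurable hgm.enorm.aemeasurable hp1
  calc _ ≤ _ := hloc.trans key
    _ ≤ _ := mul_le_mul_right hint _
    _ = _ := by ring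

theorem measurable_eLpNorm_of_uncurry {Y X : Type*} [MeasurableSpace Y] [MeasurableSpace X]
    (μ : Measure X) [SFinite μ] (s : ℝ≥0∞) {u : Y → X → ℝ}
    (hu : Measurable (Function.uncurry u)) : Measurable fun t ↦ eLpNorm (u t) s μ := by
  by_cases h0 : s = 0
  · simp [h0]
  by_cases htop : s = ⊤
  · subst htop
    simp only [eLpNorm_exponent_top, eLpNormEssSup]
    refine measurable_of_Iic fun c ↦ ?_
    have : (fun t ↦ essSup (fun x ↦ ‖u t x‖ₑ) μ) ⁻¹' Set.Iic c =
        {t | μ (Prod.mk t ⁻¹' {z : Y × X | c < ‖Function.uncurry u z‖ₑ}) = 0} := by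
      ext t
      have hiff : essSup (fun x ↦ ‖u t x‖ₑ) μ ≤ c ↔ ∀ᵐ x ∂μ, ‖u t x‖ₑ ≤ c :=
        ⟨fun h ↦ (ENNReal.ae_le_essSup fun x ↦ ‖u t x‖ₑ).mono fun x hx ↦ hx.trans h,
          fun h ↦ essSup_le_of_ae_le c h⟩
      simp only [Set.mem_preimage, Set.mem_Iic, hiff, ae_iff, not_le, Set.mem_ofPred_eq]
      rfl
    rw [this]
    exact measurable_measure_prodMk_left (measurableSet_lt measurable_const hu.enorm)
      (measurableSet_singleton 0)
  · simp_rw [eLpNorm_eq_lintegral_rpow_enorm_toReal h0 htop]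
    exact (Measurable.lintegral_prod_right' (hu.enorm.pow_const s.toReal)).pow_const _

theorem ae_eLpNorm_lt_top_of_mixedNorm_ne_top {α : Type*} [MeasurableSpace α] {μ : Measure α}
    {T : ℝ} {q s : ℝ≥0∞} (hq : 1 ≤ q) {u : ℝ → α → ℝ}
    (hu : Measurable fun t ↦ eLpNorm (u t) s μ) (h : mixedNorm μ T q s u ≠ ⊤) :
    ∀ᵐ t ∂volume.restrict (Set.Ioc 0 T), eLpNorm (u t) s μ < ⊤ := by
  rw [mixedNorm] at h
  split_ifs at h with hqt
  · exact (ENNReal.ae_le_essSup fun t ↦ eLpNorm (u t) s μ).mono fun t ht ↦ ht.trans_lt h.lt_top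
  · have hq0 : 0 < q.toReal := ENNReal.toReal_pos (by positivity) hqt
    have h' : ∫⁻ t in Set.Ioc (0 : ℝ) T, eLpNorm (u t) s μ ^ q.toReal ≠ ⊤ := fun h' ↦ by
      rw [h', ENNReal.top_rpow_of_pos (by positivity)] at h
      exact h rfl
    filter_upwards [ae_lt_top (hu.pow_const _) h'] with t ht
    rwa [ENNReal.rpow_lt_top_iff_of_pos hq0] at ht

theorem lintegral_mul_le_mixedNorm {α : Type*} [MeasurableSpace α] {μ : Measure α}
    {T : ℝ} {q q' s s' : ℝ≥0∞} (hqq' : q⁻¹ + q'⁻¹ = 1) {u v : ℝ → α → ℝ}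
    (hu : Measurable fun t ↦ eLpNorm (u t) s μ) (hv : Measurable fun t ↦ eLpNorm (v t) s' μ) :
    ∫⁻ t in Set.Ioc (0 : ℝ) T, eLpNorm (u t) s μ * eLpNorm (v t) s' μ ≤
      mixedNorm μ T q s u * mixedNorm μ T q' s' v := by
  by_cases hq : q = ⊤
  · have hq' : q' = 1 := by simpa [hq] using hqq'
    simp only [mixedNorm, hq, hq', if_true, ENNReal.one_ne_top, if_false, ENNReal.toReal_one,
      ENNReal.rpow_one, div_one]
    rw [← lintegral_const_mul _ hv]
    refine lintegral_mono_ae ?_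
    filter_upwards [ENNReal.ae_le_essSup (μ := volume.restrict (Set.Ioc 0 T))
      fun t ↦ eLpNorm (u t) s μ] with t ht
    gcongr
  by_cases hq' : q' = ⊤
  · have hq1 : q = 1 := by simpa [hq'] using hqq'
    simp only [mixedNorm, hq1, hq', if_true, ENNReal.one_ne_top, if_false, ENNReal.toReal_one,
      ENNReal.rpow_one, div_one]
    rw [← lintegral_mul_const _ hu]
    refine lintegral_mono_ae ?_
    filter_upwards [ENNReal.ae_le_essSup (μ := volume.restrict (Set.Ioc 0 T))
      fun t ↦ eLpNorm (v t) s' μ] with t ht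
    gcongr
  have : ENNReal.HolderConjugate q q' := ENNReal.holderConjugate_iff.2 hqq'
  have hc : q.toReal.HolderConjugate q'.toReal := ENNReal.HolderConjugate.toReal_of_ne_top hq hq'
  simp only [mixedNorm, hq, hq', if_false]
  exact ENNReal.lintegral_mul_le_Lp_mul_Lq _ hc hu.aemeasurable hv.aemeasurable

theorem exists_proj3_eq (y : T3) : ∃ h : Fin 3 → ℝ, proj3 h = y ∧ ‖h‖ ≤ ‖y‖ := by
  have : ∀ i, ∃ r : ℝ, (r : AddCircle (1 : ℝ)) = y i ∧ |r| = ‖y i‖ := by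
    intro i
    obtain ⟨x, hx⟩ := QuotientAddGroup.mk_surjective (y i)
    refine ⟨x - round x, ?_, ?_⟩
    · rw [← hx]
      have h1 : ((round x : ℝ) : AddCircle (1 : ℝ)) = 0 := by
        rw [AddCircle.coe_eq_zero_iff]
        exact ⟨round x, by simp⟩
      rw [AddCircle.coe_sub, h1, sub_zero]
    · rw [← hx]
      have := AddCircle.norm_eq (1 : ℝ) (x := x)
      simp only [inv_one, one_mul, mul_one] at this
      exact this.symm
  choose h h1 h2 using this
  refine ⟨h, funext h1, (pi_norm_le_iff_of_nonneg (norm_nonneg _)).2 fun i ↦ ?_⟩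
  rw [Real.norm_eq_abs, h2]
  exact norm_le_pi_norm y i

/-- The commutator at a fixed time is controlled by the `L^s` modulus of continuity of the first
factor. -/
theorem eLpNorm_commutator_le {s s' : ℝ≥0∞} (hss' : s⁻¹ + s'⁻¹ = 1) {α β φ : T3 → ℝ}
    (hα : Measurable α) (hβ : Measurable β) (hφ : Measurable φ) (hφpos : ∀ y, 0 ≤ φ y)
    (hφint : ∫ y, φ y = 1) {W : ℝ≥0∞} (hW : W ≠ ⊤)
    (hαW : ∀ y, φ y ≠ 0 → eLpNorm (fun x ↦ α (x - y) - α x) s volume ≤ W)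
    (hβs : eLpNorm β s' volume ≠ ⊤) :
    eLpNorm (fun x ↦ α x * (∫ y, β (x - y) * φ y) - ∫ y, α (x - y) * β (x - y) * φ y) 1 volume ≤
      W * eLpNorm β s' volume := by
  have hφl : ∫⁻ y, ‖φ y‖ₑ = 1 := by
    have hi : Integrable φ := by
      by_contra h
      rw [integral_undef h] at hφint
      exact zero_ne_one hφint
    simp_rw [fun y ↦ Real.enorm_of_nonneg (hφpos y)]
    rw [← ofReal_integral_eq_lintegral_ofReal hi (Eventually.of_forall hφpos), hφint,
      ENNReal.ofReal_one]
  have hs' : 1 ≤ s' := by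
    rw [← ENNReal.inv_le_one, ← hss']
    exact le_add_self
  have hβ1 : eLpNorm β 1 volume ≠ ⊤ :=
    ne_top_of_le_ne_top hβs (eLpNorm_le_eLpNorm_of_exponent_le hs' hβ.aestronglyMeasurable)
  have htr : ∀ (r : ℝ≥0∞) y, eLpNorm (fun x ↦ β (x - y)) r volume = eLpNorm β r volume :=
    fun r y ↦ eLpNorm_comp_measurePreserving hβ.aestronglyMeasurable
      (measurePreserving_sub_right volume y)
  have m1 : Measurable (Function.uncurry fun x y : T3 ↦ (α (x - y) - α x) * β (x - y) * φ y) := by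
    unfold Function.uncurry
    fun_prop
  have m2 : Measurable (Function.uncurry fun x y : T3 ↦ β (x - y) * φ y) := by
    unfold Function.uncurry
    fun_prop
  have I1 : ∫⁻ x, ∫⁻ y, ‖(α (x - y) - α x) * β (x - y) * φ y‖ₑ ≤ W * eLpNorm β s' volume := by
    rw [lintegral_lintegral_swap m1.enorm.aemeasurable]
    calc _ ≤ ∫⁻ y, W * eLpNorm β s' volume * ‖φ y‖ₑ := by
          refine lintegral_mono fun y ↦ ?_
          simp only [enorm_mul _ (φ y)]
          rw [lintegral_mul_const _ (by fun_prop)]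
          by_cases hy : φ y = 0
          · simp [hy]
          gcongr
          have : s.HolderTriple s' 1 := ⟨by rw [hss', inv_one]⟩
          have h := eLpNorm_smul_le_mul_eLpNorm (μ := (volume : Measure T3)) (p := s) (q := s')
            (r := 1) (f := fun x ↦ β (x - y)) (φ := fun x ↦ α (x - y) - α x)
            (hβ.comp (measurable_id.sub_const y)).aestronglyMeasurable
            ((hα.comp (measurable_id.sub_const y)).sub hα).aestronglyMeasurable
          rw [eLpNorm_one_eq_lintegral_enorm, htr] at h
          exact h.trans (by gcongr; exact hαW y hy)
      _ = _ := by rw [lintegral_const_mul _ hφ.enorm, hφl, mul_one]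
  have I2 : ∫⁻ x, ∫⁻ y, ‖β (x - y) * φ y‖ₑ ≤ eLpNorm β 1 volume := by
    rw [lintegral_lintegral_swap m2.enorm.aemeasurable]
    calc _ ≤ ∫⁻ y, eLpNorm β 1 volume * ‖φ y‖ₑ := by
          refine lintegral_mono fun y ↦ ?_
          simp only [enorm_mul]
          rw [lintegral_mul_const _ (by fun_prop), ← htr 1 y, eLpNorm_one_eq_lintegral_enorm]
      _ = _ := by rw [lintegral_const_mul _ hφ.enorm, hφl, mul_one]
  rw [eLpNorm_one_eq_lintegral_enorm]
  refine le_trans (lintegral_mono_ae ?_) I1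
  filter_upwards [ae_lt_top (m1.enorm.lintegral_prod_right')
    (ne_top_of_le_ne_top (by finiteness) I1), ae_lt_top (m2.enorm.lintegral_prod_right')
    (ne_top_of_le_ne_top (by finiteness) I2)] with x h1 h2
  have i1 : Integrable fun y ↦ (α (x - y) - α x) * β (x - y) * φ y :=
    ⟨(m1.comp measurable_prodMk_left).aestronglyMeasurable, h1⟩
  have i2 : Integrable fun y ↦ β (x - y) * φ y :=
    ⟨(m2.comp measurable_prodMk_left).aestronglyMeasurable, h2⟩
  have e : ∫ y, α (x - y) * β (x - y) * φ y =
      (∫ y, (α (x - y) - α x) * β (x - y) * φ y) + α x * ∫ y, β (x - y) * φ y := by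
    rw [← integral_const_mul, ← integral_add i1 (i2.const_mul _)]
    congr with y
    ring
  rw [e, sub_add_cancel_right, enorm_neg]
  exact enorm_integral_le_lintegral_enorm _

/-- Commutator lemma (Friedrichs/DiPerna–Lions type): with `(a_ε)` bounded in
`L^q_t(W^{1,p}(𝕋³))` (weak gradients `G_ε`), `(b_ε)` bounded in `L^{q'}_t(L^{s'}(𝕋³))`,
`p ∈ [1,3)`, `s < p* = 3p/(3−p)`, and `(φ_k)` a sequence of even mollifiers on `𝕋³`,
the commutator `S_{ε,k} = a_ε (b_ε ⋆ φ_k) − (a_ε b_ε) ⋆ φ_k` (convolution in `x` only)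
tends to `0` in `L¹([0,T] × 𝕋³)` as `k → ∞`, uniformly in `ε`. -/
theorem commutator_lemma
    (T : ℝ) (hT : 0 < T) {ι : Type*}
    (q q' s' : ℝ≥0∞) (hq : 1 ≤ q) (p s : ℝ)
    (hp1 : 1 ≤ p) (hp3 : p < 3) (hs1 : 1 ≤ s) (hs : s < 3 * p / (3 - p))
    (hqq' : q⁻¹ + q'⁻¹ = 1) (hss' : (ENNReal.ofReal s)⁻¹ + s'⁻¹ = 1)
    (a : ι → ℝ → T3 → ℝ) (G : ι → ℝ → T3 → Fin 3 → ℝ) (b : ι → ℝ → T3 → ℝ)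
    (hameas : ∀ e, Measurable (Function.uncurry (a e)))
    (hbmeas : ∀ e, Measurable (Function.uncurry (b e)))
    (hGmeas : ∀ e i, Measurable (Function.uncurry fun t x => G e t x i))
    -- `G e t` is the weak (distributional) spatial gradient of `a e t`:
    (hweak : ∀ e t (i : Fin 3) (ψ : (Fin 3 → ℝ) → ℝ), ContDiff ℝ (⊤ : ℕ∞) ψ →
      HasCompactSupport ψ →
      ∫ y, liftT3 (a e t) y * pd ψ i y = - ∫ y, liftT3 (fun x => G e t x i) y * ψ y)
    (C : ℝ≥0∞) (hC : C ≠ ⊤)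
    (habound : ∀ e, mixedNorm volume T q (ENNReal.ofReal p) (a e) +
      mixedNorm volume T q (ENNReal.ofReal p) (fun t x => ‖G e t x‖) ≤ C)
    (hbbound : ∀ e, mixedNorm volume T q' s' (b e) ≤ C)
    -- even mollifiers on the torus, with shrinking supports:
    (φ : ℕ → T3 → ℝ)
    (hφmeas : ∀ k, Measurable (φ k))
    (hφpos : ∀ k y, 0 ≤ φ k y)
    (hφint : ∀ k, ∫ y, φ k y = 1)
    (hφeven : ∀ k y, φ k (-y) = φ k y)
    (hφsupp : ∀ k, Function.support (φ k) ⊆ Metric.ball (0 : T3) ((k + 1 : ℝ)⁻¹)) :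
    ∀ δ > (0:ℝ), ∃ K : ℕ, ∀ k ≥ K, ∀ e,
      mixedNorm volume T 1 1
          (fun t x => a e t x * (∫ y, b e t (x - y) * φ k y) -
            ∫ y, a e t (x - y) * b e t (x - y) * φ k y) ≤ ENNReal.ofReal δ := by
  have hp0 : 0 < p := by linarith
  have hpr : p < 3 * p / (3 - p) := by
    rw [lt_div_iff₀ (by linarith)]
    nlinarith
  obtain ⟨θ, hθ, M, hM, H⟩ := exists_eLpNorm_translate_sub_le_torus hp1 hp3 (le_max_left p s)
    (max_lt hpr hs)
  have hq' : 1 ≤ q' := by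
    rw [← ENNReal.inv_le_one, ← hqq']
    exact le_add_self
  intro δ hδ
  have hlim : Tendsto (fun k : ℕ ↦ M * ENNReal.ofReal ((k + 1 : ℝ)⁻¹) ^ θ * (C * C)) atTop
      (nhds 0) := by
    have h1 : Tendsto (fun k : ℕ ↦ ENNReal.ofReal ((k + 1 : ℝ)⁻¹) ^ θ) atTop (nhds 0) := by
      have := (ENNReal.continuous_rpow_const (y := θ)).tendsto 0 |>.comp
        (ENNReal.tendsto_ofReal (tendsto_one_div_add_atTop_nhds_zero_nat (𝕜 := ℝ)) |>.trans
          (by simp))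
      simpa [Function.comp_def, ENNReal.zero_rpow_of_pos hθ] using this
    have h2 := ENNReal.Tendsto.mul_const (b := C * C)
      (ENNReal.Tendsto.const_mul h1 (Or.inr hM)) (Or.inr (by finiteness))
    simpa using h2
  obtain ⟨K, hK⟩ := eventually_atTop.1
    (hlim.eventually (ge_mem_nhds (ENNReal.ofReal_pos.2 hδ)))
  refine ⟨K, fun k hk e ↦ le_trans ?_ (hK k hk)⟩
  set W := M * ENNReal.ofReal ((k + 1 : ℝ)⁻¹) ^ θ with hWdef
  have hW : W ≠ ⊤ := by finiteness
  have hGm : Measurable (Function.uncurry fun t x ↦ ‖G e t x‖) :=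
    (measurable_pi_iff.2 (hGmeas e) : Measurable (Function.uncurry (G e))).norm
  have ma := measurable_eLpNorm_of_uncurry volume (ENNReal.ofReal p) (hameas e)
  have mg := measurable_eLpNorm_of_uncurry volume (ENNReal.ofReal p) hGm
  have mb := measurable_eLpNorm_of_uncurry volume s' (hbmeas e)
  have fa := ae_eLpNorm_lt_top_of_mixedNorm_ne_top hq ma
    (ne_top_of_le_ne_top hC (le_self_add.trans (habound e)))
  have fg := ae_eLpNorm_lt_top_of_mixedNorm_ne_top hq mg
    (ne_top_of_le_ne_top hC (le_add_self.trans (habound e)))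
  have fb := ae_eLpNorm_lt_top_of_mixedNorm_ne_top hq' mb (ne_top_of_le_ne_top hC (hbbound e))
  have hk1 : ((k : ℝ) + 1)⁻¹ ≤ 1 := inv_le_one_of_one_le₀ (by linarith [k.cast_nonneg (α := ℝ)])
  calc _ = ∫⁻ t in Set.Ioc (0 : ℝ) T, eLpNorm (fun x ↦ a e t x * (∫ y, b e t (x - y) * φ k y) -
            ∫ y, a e t (x - y) * b e t (x - y) * φ k y) 1 volume := by
        simp [mixedNorm]
    _ ≤ ∫⁻ t in Set.Ioc (0 : ℝ) T, W * (eLpNorm (a e t) (ENNReal.ofReal p) volume *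
          eLpNorm (b e t) s' volume + eLpNorm (fun x ↦ ‖G e t x‖) (ENNReal.ofReal p) volume *
          eLpNorm (b e t) s' volume) := by
        refine lintegral_mono_ae ?_
        filter_upwards [fa, fg, fb] with t hat hgt hbt
        have mat : Measurable (a e t) := (hameas e).of_uncurry_left
        rw [← add_mul, ← mul_assoc]
        refine eLpNorm_commutator_le hss' mat (hbmeas e).of_uncurry_left (hφmeas k) (hφpos k)
          (hφint k) (by finiteness) (fun y hy ↦ ?_) hbt.ne
        have hyk : ‖y‖ < (k + 1 : ℝ)⁻¹ := by simpa using hφsupp k hy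
        obtain ⟨h, h1, h2⟩ := exists_proj3_eq (-y)
        rw [norm_neg] at h2
        have key := H (a e t) (G e t) mat (fun i ↦ (hGmeas e i).of_uncurry_left) hat.ne hgt.ne
          (hweak e t) h (by linarith)
        simp only [h1, ← sub_eq_add_neg] at key
        refine (eLpNorm_le_eLpNorm_of_exponent_le
          (ENNReal.ofReal_le_ofReal (le_max_right p s)) (by fun_prop)).trans (key.trans ?_)
        rw [hWdef]
        gcongr
        rw [← ofReal_norm]
        exact ENNReal.ofReal_le_ofReal (by linarith)
    _ = W * ((∫⁻ t in Set.Ioc (0 : ℝ) T, eLpNorm (a e t) (ENNReal.ofReal p) volume *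
          eLpNorm (b e t) s' volume) + ∫⁻ t in Set.Ioc (0 : ℝ) T,
          eLpNorm (fun x ↦ ‖G e t x‖) (ENNReal.ofReal p) volume *
          eLpNorm (b e t) s' volume) := by
        rw [lintegral_const_mul _ (by fun_prop),
          lintegral_add_left (by fun_prop)]
    _ ≤ W * (mixedNorm volume T q (ENNReal.ofReal p) (a e) * mixedNorm volume T q' s' (b e) +
          mixedNorm volume T q (ENNReal.ofReal p) (fun t x ↦ ‖G e t x‖) *
          mixedNorm volume T q' s' (b e)) := by
        gcongr
        · exact lintegral_mul_le_mixedNorm hqq' ma mb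
        · exact lintegral_mul_le_mixedNorm hqq' mg mb
    _ ≤ W * (C * C) := by
        rw [← add_mul]
        gcongr
        · exact habound e
        · exact hbbound e
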